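/- For every Schwartz function f : ℝ³ → ℂ⁴, the quantity Q(f) := ∫_{ℝ³}∫_{ℝ³} ∑_{σ,τ=1}^4 conj(f_σ(x))·γ(x,σ;y,τ)·f_τ(y) / |x−y| dx dy is a real number and satisfies 0 ≤ Q(f) ≤ ∫_{ℝ³} ‖f(x)‖²·φ_γ(x) dx. In other words, the exchange operator X_γ is nonnegative and bounded above, as a quadratic form, by multiplication by the mean-field potential φ_γ. -/

import Mathlib

noncomputable section
open MeasureTheory SchwartzMap Real

/-- Position space `ℝ³`. -/
abbrev Space : Type := EuclideanSpace ℝ (Fin 3)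

/-- Spinor space `ℂ⁴`, with the Euclidean (ℓ²) norm, so that
`‖v‖² = ∑_{σ=1}^4 |v_σ|²`. -/
abbrev Spinor : Type := EuclideanSpace ℂ (Fin 4)

/-- Orbital data: an orthonormal family `(ξ_n)` of Schwartz functions in `L²(ℝ³; ℂ⁴)`
together with nonnegative occupation numbers `(λ_n)` with `∑ λ_n < ∞`. -/
structure OrbitalData where
  xi : ℕ → SchwartzMap Space Spinor
  lam : ℕ → ℝ
  lam_nonneg : ∀ n, 0 ≤ lam n
  lam_summable : Summable lam
  orthonormal : ∀ m n : ℕ,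
    ∫ x : Space, (inner ℂ (xi m x) (xi n x) : ℂ) = if m = n then 1 else 0

/-- The density `ρ_γ(x) = ∑_n λ_n ∑_{σ=1}^4 |ξ_n(x,σ)|²`. -/
def OrbitalData.density (Γ : OrbitalData) (x : Space) : ℝ :=
  ∑' n, Γ.lam n * ‖Γ.xi n x‖ ^ 2

/-- The density-matrix kernel `γ(x,σ;y,τ) = ∑_n λ_n ξ_n(x,σ) conj(ξ_n(y,τ))`. -/
def OrbitalData.kernel (Γ : OrbitalData) (x y : Space) (σ τ : Fin 4) : ℂ :=
  ∑' n, Γ.lam n * Γ.xi n x σ * (starRingEnd ℂ) (Γ.xi n y τ)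

/-- The square-root kernel `γ^{1/2}(x,σ;y,τ) = ∑_n √λ_n ξ_n(x,σ) conj(ξ_n(y,τ))`. -/
def OrbitalData.sqrtKernel (Γ : OrbitalData) (x y : Space) (σ τ : Fin 4) : ℂ :=
  ∑' n, Real.sqrt (Γ.lam n) * Γ.xi n x σ * (starRingEnd ℂ) (Γ.xi n y τ)

/-- The (componentwise) Fourier transform `ξ̂_n` of the orbital `ξ_n`. -/
def OrbitalData.fourier (Γ : OrbitalData) (n : ℕ) : SchwartzMap Space Spinor :=
  fourierTransformCLM ℂ (Γ.xi n)

/-- `tr(|p|γ) = ∑_n λ_n ∫ |p| ‖ξ̂_n(p)‖² dp`. -/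
def OrbitalData.trMomentum (Γ : OrbitalData) : ℝ :=
  ∑' n, Γ.lam n * ∫ p : Space, ‖p‖ * ‖Γ.fourier n p‖ ^ 2

/-- `tr(T_c γ) = ∑_n λ_n ∫ (√(c²|p|²+c⁴) − c²) ‖ξ̂_n(p)‖² dp`. -/
def OrbitalData.trKinetic (c : ℝ) (Γ : OrbitalData) : ℝ :=
  ∑' n, Γ.lam n *
    ∫ p : Space, (Real.sqrt (c ^ 2 * ‖p‖ ^ 2 + c ^ 4) - c ^ 2) * ‖Γ.fourier n p‖ ^ 2

/-- The mean-field (Coulomb) potential `φ_γ(x) = ∫ ρ_γ(y)/|x−y| dy`. -/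
def OrbitalData.meanField (Γ : OrbitalData) (x : Space) : ℝ :=
  ∫ y : Space, Γ.density y / ‖x - y‖

/-- The exchange energy `𝒳[γ] = ½ ∫∫ ∑_{σ,τ} |γ(x,σ;y,τ)|²/|x−y| dx dy`. -/
def OrbitalData.exchange (Γ : OrbitalData) : ℝ :=
  (1 / 2) * ∫ x : Space, ∫ y : Space,
    (∑ σ : Fin 4, ∑ τ : Fin 4, ‖Γ.kernel x y σ τ‖ ^ 2) / ‖x - y‖

/-- The Müller exchange energy `𝒳[γ^{1/2}]`. -/
def OrbitalData.exchangeSqrt (Γ : OrbitalData) : ℝ :=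
  (1 / 2) * ∫ x : Space, ∫ y : Space,
    (∑ σ : Fin 4, ∑ τ : Fin 4, ‖Γ.sqrtKernel x y σ τ‖ ^ 2) / ‖x - y‖

/-- The Coulomb energy `D[ρ] = ½ ∫∫ ρ(x)ρ(y)/|x−y| dx dy`. -/
def coulombD (ρ : Space → ℝ) : ℝ :=
  (1 / 2) * ∫ x : Space, ∫ y : Space, ρ x * ρ y / ‖x - y‖

open Complex in
/-- The three Dirac `α` matrices in standard representation. -/
def diracAlpha : Fin 3 → Matrix (Fin 4) (Fin 4) ℂ
  | 0 => !![0, 0, 0, 1; 0, 0, 1, 0; 0, 1, 0, 0; 1, 0, 0, 0]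
  | 1 => !![0, 0, 0, -I; 0, 0, I, 0; 0, -I, 0, 0; I, 0, 0, 0]
  | 2 => !![0, 0, 1, 0; 0, 0, 0, -1; 1, 0, 0, 0; 0, -1, 0, 0]

/-- The Dirac `β` matrix in standard representation. -/
def diracBeta : Matrix (Fin 4) (Fin 4) ℂ :=
  !![1, 0, 0, 0; 0, 1, 0, 0; 0, 0, -1, 0; 0, 0, 0, -1]

/-- The positive-energy Dirac projection
`Λ₊(p) = ½ (1 + (c α·p + βc²)/√(c²|p|²+c⁴))`. -/
def posProj (c : ℝ) (p : Space) : Matrix (Fin 4) (Fin 4) ℂ :=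
  (1 / 2 : ℂ) • (1 + ((Real.sqrt (c ^ 2 * ‖p‖ ^ 2 + c ^ 4) : ℂ))⁻¹ •
    ((c : ℂ) • (∑ j : Fin 3, (p j : ℂ) • diracAlpha j) + ((c : ℂ) ^ 2) • diracBeta))

/-- The orbital data belongs to the free picture (for velocity of light `c`) if each
`ξ̂_n(p)` lies in the range of the positive-energy projection `Λ₊(p)` for a.e. `p`. -/
def OrbitalData.FreePicture (c : ℝ) (Γ : OrbitalData) : Prop :=
  ∀ n : ℕ, ∀ᵐ p : Space, ∀ σ : Fin 4,
    Γ.fourier n p σ = ∑ τ : Fin 4, posProj c p σ τ * Γ.fourier n p τ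

theorem summable_norm_ae_and_integrable_tsum {ι α E : Type*} [Countable ι] [MeasurableSpace α]
    {μ : Measure α} [NormedAddCommGroup E] [CompleteSpace E] {F : ι → α → E}
    (hF : ∀ i, Integrable (F i) μ) (hsum : Summable fun i ↦ ∫ a, ‖F i a‖ ∂μ) :
    (∀ᵐ a ∂μ, Summable fun i ↦ ‖F i a‖) ∧ Integrable (fun a ↦ ∑' i, F i a) μ := by
  have hlt : ∫⁻ a, ∑' i, ‖F i a‖ₑ ∂μ < ⊤ := by
    rw [lintegral_tsum fun i ↦ (hF i).1.enorm]
    have h : ∀ i, ∫⁻ a, ‖F i a‖ₑ ∂μ = ENNReal.ofReal (∫ a, ‖F i a‖ ∂μ) := fun i ↦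
      (ofReal_integral_norm_eq_lintegral_enorm (hF i)).symm
    simp_rw [h]
    exact hsum.tsum_ofReal_lt_top
  have hae : ∀ᵐ a ∂μ, Summable fun i ↦ ‖F i a‖ := by
    filter_upwards [ae_lt_top' (AEMeasurable.tsum fun i ↦ (hF i).1.enorm) hlt.ne]
      with a ha
    exact NNReal.summable_coe.2 (ENNReal.tsum_coe_ne_top_iff_summable.1 ha.ne)
  refine ⟨hae, ?_, ?_⟩
  · refine aestronglyMeasurable_of_tendsto_ae (Filter.atTop : Filter (Finset ι))
      (f := fun s a ↦ ∑ i ∈ s, F i a) ?_ ?_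
    · intro s
      exact Finset.aestronglyMeasurable_fun_sum s fun i _ ↦ (hF i).1
    · filter_upwards [hae] with a ha
      exact ha.of_norm.hasSum
  · refine lt_of_le_of_lt (lintegral_mono fun a ↦ ?_) hlt
    exact enorm_tsum_le_tsum_enorm

theorem integral_gaussian_mul_gaussian (x y : Space) {b : ℝ} (hb : 0 < b) :
    Integrable (fun z : Space ↦ rexp (-b * ‖x - z‖ ^ 2) * rexp (-b * ‖y - z‖ ^ 2)) ∧
    ∫ z : Space, rexp (-b * ‖x - z‖ ^ 2) * rexp (-b * ‖y - z‖ ^ 2) =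
      (π / (2 * b)) ^ (3 / 2 : ℝ) * rexp (-(b / 2) * ‖x - y‖ ^ 2) := by
  have key : (fun z : Space ↦ rexp (-b * ‖x - z‖ ^ 2) * rexp (-b * ‖y - z‖ ^ 2)) =
      fun z : Space ↦ rexp (-(b / 2) * ‖x - y‖ ^ 2) *
        rexp (-(2 * b) * ‖z - (1 / 2 : ℝ) • (x + y)‖ ^ 2) := by
    ext z
    rw [← Real.exp_add, ← Real.exp_add]
    congr 1
    simp only [EuclideanSpace.real_norm_sq_eq, Fin.sum_univ_three, PiLp.sub_apply,
      PiLp.smul_apply, PiLp.add_apply, smul_eq_mul]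
    ring
  have hb2 : 0 < 2 * b := by positivity
  have hg := GaussianFourier.integral_rexp_neg_mul_sq_norm (V := Space) hb2
  have hi : Integrable (fun z : Space ↦ rexp (-(2 * b) * ‖z‖ ^ 2)) := by
    refine Integrable.of_integral_ne_zero ?_
    rw [hg]
    positivity
  rw [key]
  refine ⟨(hi.comp_sub_right _).const_mul _, ?_⟩
  rw [integral_const_mul, integral_sub_right_eq_self
    (fun z : Space ↦ rexp (-(2 * b) * ‖z‖ ^ 2)), hg, mul_comm]
  simp

/-- The weight in `s` for which the Coulomb kernel is a superposition of Gaussian products. -/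
def coulombWeight (s : ℝ) : ℝ :=
  (√π * (π / (2 * (2 * s ^ 2))) ^ (3 / 2 : ℝ))⁻¹

theorem coulombWeight_nonneg (s : ℝ) : 0 ≤ coulombWeight s := by
  unfold coulombWeight; positivity

/-- A function of `(s, z) ∈ ℝ × ℝ³` whose correlations `∫ k x p * k y p dp` are `1 / ‖x - y‖`. -/
def coulombFactor (x : Space) (p : ℝ × Space) : ℝ :=
  √(coulombWeight p.1) * rexp (-(2 * p.1 ^ 2) * ‖x - p.2‖ ^ 2)

theorem coulombFactor_nonneg (x : Space) (p : ℝ × Space) : 0 ≤ coulombFactor x p := by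
  unfold coulombFactor; positivity

theorem coulombFactor_mul (x y : Space) (s : ℝ) (z : Space) :
    coulombFactor x (s, z) * coulombFactor y (s, z) = coulombWeight s *
      (rexp (-(2 * s ^ 2) * ‖x - z‖ ^ 2) * rexp (-(2 * s ^ 2) * ‖y - z‖ ^ 2)) := by
  unfold coulombFactor
  rw [mul_mul_mul_comm, Real.mul_self_sqrt (coulombWeight_nonneg s)]

theorem integral_coulombFactor_mul_right (x y : Space) {s : ℝ} (hs : s ≠ 0) :
    ∫ z : Space, coulombFactor x (s, z) * coulombFactor y (s, z) =
      (√π)⁻¹ * rexp (-‖x - y‖ ^ 2 * s ^ 2) := by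
  simp_rw [coulombFactor_mul]
  rw [integral_const_mul, (integral_gaussian_mul_gaussian x y (by positivity)).2, coulombWeight,
    mul_inv, mul_assoc, inv_mul_cancel_left₀ (by positivity)]
  congr 2
  ring

theorem integrable_coulombFactor_mul_right (x y : Space) (s : ℝ) :
    Integrable fun z : Space ↦ coulombFactor x (s, z) * coulombFactor y (s, z) := by
  simp_rw [coulombFactor_mul]
  rcases eq_or_ne s 0 with rfl | hs
  · simp [coulombWeight]
  · exact (integral_gaussian_mul_gaussian x y (by positivity)).1.const_mul _

theorem integrable_coulombFactor_mul {x y : Space} (hxy : x ≠ y) :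
    Integrable fun p ↦ coulombFactor x p * coulombFactor y p := by
  have hr : 0 < ‖x - y‖ ^ 2 := by have := norm_pos_iff.2 (sub_ne_zero.2 hxy); positivity
  have hm : Measurable fun p ↦ coulombFactor x p * coulombFactor y p := by
    unfold coulombFactor coulombWeight
    fun_prop
  rw [Measure.volume_eq_prod, integrable_prod_iff hm.aestronglyMeasurable]
  refine ⟨.of_forall fun s ↦ integrable_coulombFactor_mul_right x y s, ?_⟩
  refine ((integrable_exp_neg_mul_sq hr).const_mul (√π)⁻¹).congr ?_
  filter_upwards [Measure.ae_ne volume (0 : ℝ)] with s hs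
  rw [← integral_coulombFactor_mul_right x y hs]
  refine integral_congr_ae (.of_forall fun z ↦ ?_)
  exact (Real.norm_of_nonneg
    (mul_nonneg (coulombFactor_nonneg _ _) (coulombFactor_nonneg _ _))).symm

theorem integral_coulombFactor_mul {x y : Space} (hxy : x ≠ y) :
    ∫ p, coulombFactor x p * coulombFactor y p = 1 / ‖x - y‖ := by
  have hr : 0 < ‖x - y‖ := norm_pos_iff.2 (sub_ne_zero.2 hxy)
  rw [Measure.volume_eq_prod, integral_prod _ (integrable_coulombFactor_mul hxy)]
  have : (fun s : ℝ ↦ ∫ z : Space, coulombFactor x (s, z) * coulombFactor y (s, z)) =ᵐ[volume]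
      fun s ↦ (√π)⁻¹ * rexp (-‖x - y‖ ^ 2 * s ^ 2) := by
    filter_upwards [Measure.ae_ne volume (0 : ℝ)] with s hs
    exact integral_coulombFactor_mul_right x y hs
  rw [integral_congr_ae this, integral_const_mul, integral_gaussian, Real.sqrt_div Real.pi_nonneg,
    Real.sqrt_sq hr.le]
  field_simp


theorem ae_fst_ne_snd : ∀ᵐ p : Space × Space, p.1 ≠ p.2 := by
  rw [Measure.volume_eq_prod]
  refine (Measure.ae_prod_iff_ae_ae ?_).2 (.of_forall fun x ↦ ?_)
  · exact (measurableSet_eq_fun measurable_fst measurable_snd).compl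
  · filter_upwards [Measure.ae_ne volume x] with y hy using hy.symm

theorem integral_conj_mul_div_norm_sub {h : Space → ℂ} (hm : Measurable h)
    (hi : Integrable fun p : Space × Space ↦
      (starRingEnd ℂ) (h p.1) * h p.2 / (‖p.1 - p.2‖ : ℂ)) :
    ∫ p : Space × Space, (starRingEnd ℂ) (h p.1) * h p.2 / (‖p.1 - p.2‖ : ℂ) =
      ((∫ a, ‖∫ x, h x * (coulombFactor x a : ℂ)‖ ^ 2 : ℝ) : ℂ) := by
  let Φ : Space × Space → ℝ × Space → ℂ := fun p a ↦
    (starRingEnd ℂ) (h p.1) * h p.2 * ((coulombFactor p.1 a * coulombFactor p.2 a : ℝ) : ℂ)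
  have hΦm : Measurable (Function.uncurry Φ) := by
    have hk1 : Measurable fun q : (Space × Space) × (ℝ × Space) ↦ coulombFactor q.1.1 q.2 := by
      unfold coulombFactor coulombWeight
      fun_prop
    have hk2 : Measurable fun q : (Space × Space) × (ℝ × Space) ↦ coulombFactor q.1.2 q.2 := by
      unfold coulombFactor coulombWeight
      fun_prop
    have hc : Measurable (starRingEnd ℂ) := Complex.continuous_conj.measurable
    exact ((hc.comp (hm.comp (measurable_fst.comp measurable_fst))).mul
      (hm.comp (measurable_snd.comp measurable_fst))).mul
      (Complex.measurable_ofReal.comp (hk1.mul hk2))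
  have hΦ : Integrable (Function.uncurry Φ) (volume.prod volume) := by
    refine (integrable_prod_iff hΦm.aestronglyMeasurable).2 ⟨?_, ?_⟩
    · filter_upwards [ae_fst_ne_snd] with p hp
      exact (integrable_coulombFactor_mul hp).ofReal.const_mul
        ((starRingEnd ℂ) (h p.1) * h p.2)
    · refine hi.norm.congr ?_
      filter_upwards [ae_fst_ne_snd] with p hp
      have : ∀ a, ‖Function.uncurry Φ (p, a)‖ = ‖(starRingEnd ℂ) (h p.1) * h p.2‖ *
          (coulombFactor p.1 a * coulombFactor p.2 a) := fun a ↦ by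
        simp only [Function.uncurry, Φ]
        rw [norm_mul, Complex.norm_of_nonneg
          (mul_nonneg (coulombFactor_nonneg _ _) (coulombFactor_nonneg _ _))]
      simp_rw [this]
      rw [integral_const_mul, integral_coulombFactor_mul hp, norm_div, Complex.norm_real, norm_norm,
        mul_one_div]
  have h1 : (fun p : Space × Space ↦ (starRingEnd ℂ) (h p.1) * h p.2 / (‖p.1 - p.2‖ : ℂ))
      =ᵐ[volume] fun p ↦ ∫ a, Φ p a := by
    filter_upwards [ae_fst_ne_snd] with p hp
    simp only [Φ]
    rw [integral_const_mul, integral_complex_ofReal, integral_coulombFactor_mul hp]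
    push_cast
    rw [mul_one_div]
  rw [integral_congr_ae h1, integral_integral_swap hΦ, ← integral_complex_ofReal]
  congr 1 with a
  have : ∀ p : Space × Space, Φ p a = (starRingEnd ℂ) (h p.1 * (coulombFactor p.1 a : ℂ)) *
      (h p.2 * (coulombFactor p.2 a : ℂ)) := fun p ↦ by
    simp only [Φ, map_mul, Complex.conj_ofReal]
    push_cast
    ring
  simp_rw [this]
  rw [Measure.volume_eq_prod, integral_prod_mul
    (fun x ↦ (starRingEnd ℂ) (h x * (coulombFactor x a : ℂ)))
    (fun x ↦ h x * (coulombFactor x a : ℂ)), integral_conj, Complex.conj_mul']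
  push_cast
  rfl

theorem integrableOn_inv_norm_ball : IntegrableOn (fun x : Space ↦ ‖x‖⁻¹) (Metric.ball 0 1) := by
  refine integrableOn_ball_of_norm_le_rpow (C := 1) (α := 1) ?_ ?_ (.of_forall fun x ↦ ?_) ?_
  · simp
  · simp
  · simp [Real.rpow_neg_one]
  · exact (measurable_norm.inv).aestronglyMeasurable

theorem SchwartzMap.integrable_norm_sq (f : SchwartzMap Space Spinor) :
    Integrable fun x ↦ ‖f x‖ ^ 2 :=
  (f.memLp 2).integrable_norm_pow (by norm_num)

theorem SchwartzMap.exists_integral_norm_sq_div_le (f : SchwartzMap Space Spinor) :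
    ∃ C, ∀ y, Integrable (fun x ↦ ‖f x‖ ^ 2 / ‖x - y‖) ∧ ∫ x, ‖f x‖ ^ 2 / ‖x - y‖ ≤ C := by
  obtain ⟨M, hM⟩ : ∃ M, ∀ x, ‖f x‖ ≤ M := ⟨_, f.toBoundedContinuousFunction.norm_coe_le_norm⟩
  let g : Space → ℝ := (Metric.ball 0 1).indicator fun x ↦ ‖x‖⁻¹
  have hg : Integrable g := integrableOn_inv_norm_ball.integrable_indicator measurableSet_ball
  have hbd (y : Space) : Integrable fun x ↦ ‖f x‖ ^ 2 + M ^ 2 * g (x - y) :=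
    f.integrable_norm_sq.add ((hg.comp_sub_right y).const_mul _)
  have hle (x y : Space) : ‖f x‖ ^ 2 / ‖x - y‖ ≤ ‖f x‖ ^ 2 + M ^ 2 * g (x - y) := by
    have hf : ‖f x‖ ^ 2 ≤ M ^ 2 := by gcongr; exact hM x
    by_cases hxy : x - y ∈ Metric.ball (0 : Space) 1
    · simp only [g, Set.indicator_of_mem hxy, div_eq_mul_inv]
      have := mul_le_mul_of_nonneg_right hf (inv_nonneg.2 (norm_nonneg (x - y)))
      have := sq_nonneg ‖f x‖
      linarith
    · simp only [g, Set.indicator_of_notMem hxy, mul_zero, add_zero]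
      refine div_le_self (sq_nonneg _) ?_
      simpa using hxy
  have hi (y : Space) : Integrable fun x ↦ ‖f x‖ ^ 2 / ‖x - y‖ := by
    refine (hbd y).mono' ?_ (.of_forall fun x ↦ ?_)
    · have := f.continuous
      exact (Measurable.div (by fun_prop) (by fun_prop)).aestronglyMeasurable
    · rw [Real.norm_of_nonneg (by positivity)]
      exact hle x y
  refine ⟨(∫ x, ‖f x‖ ^ 2) + M ^ 2 * ∫ x, g x, fun y ↦ ⟨hi y, ?_⟩⟩
  refine (integral_mono (hi y) (hbd y) fun x ↦ hle x y).trans_eq ?_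
  rw [integral_add f.integrable_norm_sq ((hg.comp_sub_right y).const_mul _), integral_const_mul,
    integral_sub_right_eq_self]

theorem OrbitalData.integral_norm_sq_xi (Γ : OrbitalData) (n : ℕ) :
    ∫ x, ‖Γ.xi n x‖ ^ 2 = 1 := by
  have h := Γ.orthonormal n n
  simp only [inner_self_eq_norm_sq_to_K, if_true] at h
  have h2 : ∫ x, (((‖Γ.xi n x‖ ^ 2 : ℝ)) : ℂ) = 1 := by
    rw [← h]
    congr 1 with x
    push_cast
    rfl
  rw [← Complex.ofReal_inj, ← integral_complex_ofReal, h2, Complex.ofReal_one]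

/-- The `n`-th term of `‖f(x)‖² ρ_γ(y) / ‖x - y‖`. -/
def OrbitalData.directTerm (Γ : OrbitalData) (f : SchwartzMap Space Spinor) (n : ℕ)
    (p : Space × Space) : ℝ :=
  ‖f p.1‖ ^ 2 / ‖p.1 - p.2‖ * (Γ.lam n * ‖Γ.xi n p.2‖ ^ 2)

/-- The `n`-th term of the integrand of the exchange form. -/
def OrbitalData.exchangeTerm (Γ : OrbitalData) (f : SchwartzMap Space Spinor) (n : ℕ)
    (p : Space × Space) : ℂ :=
  Γ.lam n * ((starRingEnd ℂ) (inner ℂ (Γ.xi n p.1) (f p.1)) * inner ℂ (Γ.xi n p.2) (f p.2) /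
    (‖p.1 - p.2‖ : ℂ))

namespace OrbitalData

variable (Γ : OrbitalData) (f : SchwartzMap Space Spinor)

theorem directTerm_nonneg (n : ℕ) (p : Space × Space) : 0 ≤ Γ.directTerm f n p := by
  have := Γ.lam_nonneg n
  unfold directTerm
  positivity

theorem exists_integral_directTerm_le :
    ∃ C, ∀ n, Integrable (Γ.directTerm f n) ∧ ∫ p, Γ.directTerm f n p ≤ C * Γ.lam n := by
  obtain ⟨C, hC⟩ := f.exists_integral_norm_sq_div_le
  refine ⟨C, fun n ↦ ?_⟩
  have hlam := Γ.lam_nonneg n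
  have hxi : Integrable fun y ↦ C * (Γ.lam n * ‖Γ.xi n y‖ ^ 2) :=
    ((Γ.xi n).integrable_norm_sq.const_mul _).const_mul _
  have hm : Measurable (Γ.directTerm f n) := by
    have := f.continuous
    have := (Γ.xi n).continuous
    unfold directTerm
    fun_prop
  have hle (y : Space) : ∫ x, Γ.directTerm f n (x, y) ≤ C * (Γ.lam n * ‖Γ.xi n y‖ ^ 2) := by
    simp only [directTerm]
    rw [integral_mul_const]
    exact mul_le_mul_of_nonneg_right (hC y).2 (by positivity)
  have hi : Integrable (Γ.directTerm f n) := by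
    rw [Measure.volume_eq_prod, integrable_prod_iff' hm.aestronglyMeasurable]
    refine ⟨.of_forall fun y ↦ (hC y).1.mul_const (Γ.lam n * ‖Γ.xi n y‖ ^ 2), ?_⟩
    simp_rw [Real.norm_of_nonneg (directTerm_nonneg Γ f n _)]
    refine hxi.mono' ?_ (.of_forall fun y ↦ ?_)
    · exact (hm.stronglyMeasurable.integral_prod_left').aestronglyMeasurable
    · rw [Real.norm_of_nonneg (integral_nonneg fun x ↦ directTerm_nonneg Γ f n _)]
      exact hle y
  refine ⟨hi, ?_⟩
  rw [Measure.volume_eq_prod, integral_prod_symm _ hi]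
  refine (integral_mono hi.integral_prod_right hxi hle).trans_eq ?_
  rw [integral_const_mul, integral_const_mul, Γ.integral_norm_sq_xi, mul_one]

theorem integrable_directTerm (n : ℕ) : Integrable (Γ.directTerm f n) :=
  ((Γ.exists_integral_directTerm_le f).choose_spec n).1

theorem summable_integral_directTerm : Summable fun n ↦ ∫ p, Γ.directTerm f n p := by
  obtain ⟨C, hC⟩ := Γ.exists_integral_directTerm_le f
  exact .of_nonneg_of_le (fun n ↦ integral_nonneg (Γ.directTerm_nonneg f n))
    (fun n ↦ (hC n).2) (Γ.lam_summable.mul_left C)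

theorem summable_integral_norm_directTerm : Summable fun n ↦ ∫ p, ‖Γ.directTerm f n p‖ := by
  simpa only [Real.norm_of_nonneg (Γ.directTerm_nonneg f _ _)] using
    Γ.summable_integral_directTerm f

theorem hasSum_integral_directTerm :
    HasSum (fun n ↦ ∫ p, Γ.directTerm f n p) (∫ x, ‖f x‖ ^ 2 * Γ.meanField x) := by
  suffices h : ∫ x, ‖f x‖ ^ 2 * Γ.meanField x = ∫ p, ∑' n, Γ.directTerm f n p by
    rw [h]
    exact hasSum_integral_of_summable_integral_norm (Γ.integrable_directTerm f)
      (Γ.summable_integral_norm_directTerm f)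
  rw [Measure.volume_eq_prod, integral_prod _ (summable_norm_ae_and_integrable_tsum
    (Γ.integrable_directTerm f) (Γ.summable_integral_norm_directTerm f)).2]
  congr 1 with x
  rw [meanField, ← integral_const_mul]
  congr 1 with y
  simp only [directTerm, density]
  rw [tsum_mul_left]
  ring

theorem norm_exchangeTerm_le (n : ℕ) (p : Space × Space) :
    ‖Γ.exchangeTerm f n p‖ ≤ (1 / 2) * (Γ.directTerm f n p + Γ.directTerm f n p.swap) := by
  have hlam := Γ.lam_nonneg n
  have h1 : ‖(inner ℂ (Γ.xi n p.1) (f p.1) : ℂ)‖ * ‖(inner ℂ (Γ.xi n p.2) (f p.2) : ℂ)‖ ≤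
      (1 / 2) * (‖f p.1‖ ^ 2 * ‖Γ.xi n p.2‖ ^ 2 + ‖f p.2‖ ^ 2 * ‖Γ.xi n p.1‖ ^ 2) := by
    refine (mul_le_mul (norm_inner_le_norm _ _) (norm_inner_le_norm _ _) (norm_nonneg _)
      (by positivity)).trans ?_
    nlinarith [sq_nonneg (‖f p.1‖ * ‖Γ.xi n p.2‖ - ‖f p.2‖ * ‖Γ.xi n p.1‖)]
  simp only [exchangeTerm, directTerm, Prod.fst_swap, Prod.snd_swap, norm_mul, norm_div,
    RCLike.norm_conj, Complex.norm_real, norm_norm, Real.norm_of_nonneg hlam,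
    norm_sub_rev p.2 p.1]
  calc _ ≤ Γ.lam n * ((1 / 2) * (‖f p.1‖ ^ 2 * ‖Γ.xi n p.2‖ ^ 2 + ‖f p.2‖ ^ 2 * ‖Γ.xi n p.1‖ ^ 2)
        / ‖p.1 - p.2‖) := by gcongr
    _ = _ := by ring

theorem integrable_exchangeTerm (n : ℕ) : Integrable (Γ.exchangeTerm f n) := by
  refine (((Γ.integrable_directTerm f n).add (Γ.integrable_directTerm f n).swap).const_mul
    (1 / 2)).mono' ?_ (.of_forall (Γ.norm_exchangeTerm_le f n))
  have := f.continuous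
  have := (Γ.xi n).continuous
  unfold exchangeTerm
  refine Measurable.aestronglyMeasurable (.const_mul (.div (Continuous.measurable ?_) ?_) _)
  · have := Complex.continuous_conj
    fun_prop
  · fun_prop

theorem integral_norm_exchangeTerm_le (n : ℕ) :
    ∫ p, ‖Γ.exchangeTerm f n p‖ ≤ ∫ p, Γ.directTerm f n p := by
  have hi := Γ.integrable_directTerm f n
  refine (integral_mono (Γ.integrable_exchangeTerm f n).norm ((hi.add hi.swap).const_mul (1 / 2))
    (Γ.norm_exchangeTerm_le f n)).trans_eq ?_
  have hs : ∫ p : Space × Space, Γ.directTerm f n p.swap = ∫ p, Γ.directTerm f n p :=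
    integral_prod_swap (μ := (volume : Measure Space)) (ν := (volume : Measure Space)) _
  have ha : ∫ p, (Γ.directTerm f n p + Γ.directTerm f n p.swap) =
      (∫ p, Γ.directTerm f n p) + ∫ p : Space × Space, Γ.directTerm f n p.swap :=
    integral_add hi hi.swap
  rw [integral_const_mul]
  refine (congrArg _ ha).trans ?_
  rw [hs]
  ring

theorem exists_integral_exchangeTerm_eq (n : ℕ) :
    ∃ r : ℝ, ∫ p, Γ.exchangeTerm f n p = (r : ℂ) ∧ 0 ≤ r ∧ r ≤ ∫ p, Γ.directTerm f n p := by
  obtain ⟨r, hr, hr0⟩ : ∃ r : ℝ, ∫ p, Γ.exchangeTerm f n p = (r : ℂ) ∧ 0 ≤ r := by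
    rcases (Γ.lam_nonneg n).eq_or_lt with h0 | h0
    · exact ⟨0, by simp [exchangeTerm, ← h0], le_rfl⟩
    have hm : Measurable fun x ↦ (inner ℂ (Γ.xi n x) (f x) : ℂ) := by
      have := f.continuous
      have := (Γ.xi n).continuous
      exact Continuous.measurable (by fun_prop)
    have hi := (Γ.integrable_exchangeTerm f n).const_mul ((Γ.lam n : ℂ)⁻¹)
    have hne : (Γ.lam n : ℂ) ≠ 0 := by exact_mod_cast h0.ne'
    simp only [exchangeTerm, inv_mul_cancel_left₀ hne] at hi
    have h := integral_conj_mul_div_norm_sub hm hi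
    refine ⟨Γ.lam n * ∫ a, ‖∫ x, inner ℂ (Γ.xi n x) (f x) * (coulombFactor x a : ℂ)‖ ^ 2, ?_,
      mul_nonneg h0.le (integral_nonneg fun a ↦ sq_nonneg _)⟩
    simp only [exchangeTerm]
    rw [integral_const_mul, h, ← Complex.ofReal_mul]
  refine ⟨r, hr, hr0, ?_⟩
  have h := (norm_integral_le_integral_norm (Γ.exchangeTerm f n)).trans
    (Γ.integral_norm_exchangeTerm_le f n)
  rwa [hr, Complex.norm_of_nonneg hr0] at h

theorem summable_integral_norm_exchangeTerm :
    Summable fun n ↦ ∫ p, ‖Γ.exchangeTerm f n p‖ :=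
  .of_nonneg_of_le (fun _ ↦ integral_nonneg fun _ ↦ norm_nonneg _)
    (Γ.integral_norm_exchangeTerm_le f) (Γ.summable_integral_directTerm f)

theorem ae_summable_density : ∀ᵐ x, Summable fun n ↦ Γ.lam n * ‖Γ.xi n x‖ ^ 2 := by
  have hnn (n : ℕ) (x : Space) : 0 ≤ Γ.lam n * ‖Γ.xi n x‖ ^ 2 :=
    mul_nonneg (Γ.lam_nonneg n) (sq_nonneg _)
  have h := (summable_norm_ae_and_integrable_tsum (F := fun n x ↦ Γ.lam n * ‖Γ.xi n x‖ ^ 2)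
    (μ := volume) (fun n ↦ (Γ.xi n).integrable_norm_sq.const_mul _) ?_).1
  · simpa only [Real.norm_of_nonneg (hnn _ _)] using h
  · simpa only [Real.norm_of_nonneg (hnn _ _), integral_const_mul, Γ.integral_norm_sq_xi, mul_one]
      using Γ.lam_summable

theorem hasSum_kernel {x y : Space} (hx : Summable fun n ↦ Γ.lam n * ‖Γ.xi n x‖ ^ 2)
    (hy : Summable fun n ↦ Γ.lam n * ‖Γ.xi n y‖ ^ 2) (σ τ : Fin 4) :
    HasSum (fun n ↦ (Γ.lam n : ℂ) * Γ.xi n x σ * (starRingEnd ℂ) (Γ.xi n y τ))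
      (Γ.kernel x y σ τ) := by
  refine Summable.hasSum (.of_norm_bounded ((hx.add hy).mul_left (1 / 2)) fun n ↦ ?_)
  have hlam := Γ.lam_nonneg n
  have h1 : ‖Γ.xi n x σ‖ * ‖Γ.xi n y τ‖ ≤ (1 / 2) * (‖Γ.xi n x‖ ^ 2 + ‖Γ.xi n y‖ ^ 2) := by
    refine (mul_le_mul (PiLp.norm_apply_le _ _) (PiLp.norm_apply_le _ _) (norm_nonneg _)
      (norm_nonneg _)).trans ?_
    nlinarith [sq_nonneg (‖Γ.xi n x‖ - ‖Γ.xi n y‖)]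
  simp only [norm_mul, RCLike.norm_conj, Complex.norm_real, Real.norm_of_nonneg hlam]
  calc _ = Γ.lam n * (‖Γ.xi n x σ‖ * ‖Γ.xi n y τ‖) := by ring
    _ ≤ Γ.lam n * ((1 / 2) * (‖Γ.xi n x‖ ^ 2 + ‖Γ.xi n y‖ ^ 2)) := by gcongr
    _ = _ := by ring

theorem hasSum_exchangeTerm {p : Space × Space}
    (h1 : Summable fun n ↦ Γ.lam n * ‖Γ.xi n p.1‖ ^ 2)
    (h2 : Summable fun n ↦ Γ.lam n * ‖Γ.xi n p.2‖ ^ 2) :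
    HasSum (fun n ↦ Γ.exchangeTerm f n p) ((∑ σ : Fin 4, ∑ τ : Fin 4,
      (starRingEnd ℂ) (f p.1 σ) * Γ.kernel p.1 p.2 σ τ * f p.2 τ) / (‖p.1 - p.2‖ : ℂ)) := by
  have h := HasSum.div_const (hasSum_sum fun σ (_ : σ ∈ Finset.univ) ↦
    hasSum_sum fun τ (_ : τ ∈ Finset.univ) ↦
    ((Γ.hasSum_kernel h1 h2 σ τ).mul_left ((starRingEnd ℂ) (f p.1 σ))).mul_right (f p.2 τ))
    (‖p.1 - p.2‖ : ℂ)
  refine (congrArg (HasSum · _) (funext fun n ↦ ?_)).mp h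
  symm
  rw [exchangeTerm, ← mul_div_assoc]
  congr 1
  simp only [PiLp.inner_apply, RCLike.inner_apply, map_sum, map_mul, RCLike.conj_conj]
  rw [Finset.sum_mul_sum]
  simp only [Finset.mul_sum]
  refine Finset.sum_congr rfl fun σ _ ↦ Finset.sum_congr rfl fun τ _ ↦ ?_
  ring

theorem hasSum_integral_exchangeTerm :
    HasSum (fun n ↦ ∫ p, Γ.exchangeTerm f n p) (∫ x : Space, ∫ y : Space,
      (∑ σ : Fin 4, ∑ τ : Fin 4,
        (starRingEnd ℂ) (f x σ) * Γ.kernel x y σ τ * f y τ) / (‖x - y‖ : ℂ)) := by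
  have hae : (fun p ↦ ∑' n, Γ.exchangeTerm f n p) =ᵐ[volume] fun p : Space × Space ↦
      (∑ σ : Fin 4, ∑ τ : Fin 4, (starRingEnd ℂ) (f p.1 σ) * Γ.kernel p.1 p.2 σ τ * f p.2 τ) /
        (‖p.1 - p.2‖ : ℂ) := by
    filter_upwards [Measure.quasiMeasurePreserving_fst.ae Γ.ae_summable_density,
      Measure.quasiMeasurePreserving_snd.ae Γ.ae_summable_density] with p h1 h2
    exact (Γ.hasSum_exchangeTerm f h1 h2).tsum_eq
  have hbd := (summable_norm_ae_and_integrable_tsum (Γ.integrable_exchangeTerm f)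
    (Γ.summable_integral_norm_exchangeTerm f)).2.congr hae
  have h := hasSum_integral_of_summable_integral_norm (Γ.integrable_exchangeTerm f)
    (Γ.summable_integral_norm_exchangeTerm f)
  rwa [integral_congr_ae hae, Measure.volume_eq_prod, integral_prod _ hbd] at h

end OrbitalData

/-- For every Schwartz function `f : ℝ³ → ℂ⁴`, the quadratic form
`Q(f) = ∫∫ ∑_{σ,τ} conj(f_σ(x)) γ(x,σ;y,τ) f_τ(y)/|x−y| dx dy` is a real number and
satisfies `0 ≤ Q(f) ≤ ∫ ‖f(x)‖² φ_γ(x) dx`: the exchange operator `X_γ` is nonnegative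
and bounded above, as a quadratic form, by multiplication by `φ_γ`. -/
theorem exchange_form_nonneg_le_meanField (Γ : OrbitalData)
    (f : SchwartzMap Space Spinor) :
    ∃ q : ℝ,
      (∫ x : Space, ∫ y : Space,
          (∑ σ : Fin 4, ∑ τ : Fin 4,
            (starRingEnd ℂ) (f x σ) * Γ.kernel x y σ τ * f y τ) / (‖x - y‖ : ℂ))
        = (q : ℂ) ∧
      0 ≤ q ∧ q ≤ ∫ x : Space, ‖f x‖ ^ 2 * Γ.meanField x := by
  choose r hr hr0 hrle using Γ.exists_integral_exchangeTerm_eq f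
  have hD := Γ.hasSum_integral_directTerm f
  have hrs : Summable r := .of_nonneg_of_le hr0 hrle hD.summable
  have hE := Γ.hasSum_integral_exchangeTerm f
  simp only [hr] at hE
  exact ⟨∑' n, r n, hE.unique (Complex.hasSum_ofReal.2 hrs.hasSum), tsum_nonneg hr0,
    hasSum_le hrle hrs.hasSum hD⟩
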